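/- Let L = sl(3|2) and let M = 𝕂⁵ be the natural (vector) module, ℤ₂-graded with even part spanned by the first three standard coordinates and odd part by the last two, with action A·v = Av (matrix–vector multiplication). Then the quotient of the space of 2-cocycles of L with coefficients in M by the subspace of 2-coboundaries is one-dimensional: dim H²(L, M) = 1. The same holds for the graded dual (covector) module M* with action (A·λ)(v) = −(−1)^{|A||λ|} λ(Av). -/

import Mathlib

open Matrix

variable (K : Type) [Field K]

/-- The space of matrices underlying `gl(m|n)`. -/
abbrev gl (m n : ℕ) : Type := Matrix (Fin (m + n)) (Fin (m + n)) K

/-- The parity of an index: indices `< m` are even, the rest odd. -/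
def par (m n : ℕ) (i : Fin (m + n)) : ZMod 2 := if (i : ℕ) < m then 0 else 1

/-- `A` is homogeneous of parity `p`. -/
def IsHom {m n : ℕ} (p : ZMod 2) (A : gl K m n) : Prop :=
  ∀ i j, A i j ≠ 0 → par m n i + par m n j = p

/-- The sign `(-1)^p` for `p : ZMod 2`. -/
def sg (p : ZMod 2) : K := if p = 0 then 1 else -1

/-- The even (block-diagonal) part of a matrix. -/
def evenP {m n : ℕ} (A : gl K m n) : gl K m n :=
  Matrix.of fun i j => if par m n i = par m n j then A i j else 0

/-- The odd (block-off-diagonal) part of a matrix. -/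
def oddP {m n : ℕ} (A : gl K m n) : gl K m n :=
  Matrix.of fun i j => if par m n i = par m n j then 0 else A i j

/-- The super bracket `⟨A,B⟩ = AB - (-1)^{|A||B|} BA` on homogeneous elements,
extended bilinearly to all of `gl(m|n)`. -/
def sbr {m n : ℕ} (A B : gl K m n) : gl K m n :=
  A * B - evenP K B * A - oddP K B * evenP K A + oddP K B * oddP K A

/-- The supertrace `Str(A) = Tr(a) - Tr(d)`. -/
def str {m n : ℕ} (A : gl K m n) : K := ∑ i, sg K (par m n i) * A i i

/-- `sl(m|n)`, the subspace of supertraceless matrices, as a submodule of `gl(m|n)`. -/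
def sl (m n : ℕ) : Submodule K (gl K m n) where
  carrier := {A | str K A = 0}
  add_mem' {A B} hA hB := by
    simp only [Set.mem_setOf_eq, str] at *
    simp [Matrix.add_apply, mul_add, Finset.sum_add_distrib, hA, hB]
  zero_mem' := by simp [str]
  smul_mem' c A hA := by
    simp only [Set.mem_setOf_eq, str] at *
    simp only [Matrix.smul_apply, smul_eq_mul, mul_left_comm, ← Finset.mul_sum, hA, mul_zero]

/-- The natural (vector) module `M = 𝕂⁵` of `sl(3|2)`. -/
abbrev M5 : Type := Fin (3 + 2) → K

/-- The parity-`p` part of `M = 𝕂⁵` (resp. of its graded dual): the even part is spanned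
by the first three standard coordinates, the odd part by the last two. -/
def Mpart (p : ZMod 2) : Submodule K (M5 K) :=
  Submodule.pi Set.univ fun i => if par 3 2 i = p then (⊤ : Submodule K K) else ⊥

/-- `f` is a 2-cochain of parity `p` on `sl(3|2)` with values in the vector module (or its
dual): it is graded and super-skew-symmetric. -/
def IsCochain32 (p : ZMod 2) (f : ↥(sl K 3 2) →ₗ[K] ↥(sl K 3 2) →ₗ[K] M5 K) : Prop :=
  (∀ (pA pB : ZMod 2) (A B : ↥(sl K 3 2)),
    IsHom K pA (A : gl K 3 2) → IsHom K pB (B : gl K 3 2) →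
    f A B ∈ Mpart K (pA + pB + p)) ∧
  (∀ (pA pB : ZMod 2) (A B : ↥(sl K 3 2)),
    IsHom K pA (A : gl K 3 2) → IsHom K pB (B : gl K 3 2) →
    f B A = -(sg K (pA * pB) • f A B))

/-- The 2-cocycle condition for the vector module `M = 𝕂⁵`, where `A·v = Av`. -/
def IsCocycleVec (p : ZMod 2) (f : ↥(sl K 3 2) →ₗ[K] ↥(sl K 3 2) →ₗ[K] M5 K) : Prop :=
  ∀ (pA pB pC : ZMod 2) (A B C AB AC BC : ↥(sl K 3 2)),
    IsHom K pA (A : gl K 3 2) → IsHom K pB (B : gl K 3 2) → IsHom K pC (C : gl K 3 2) →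
    (AB : gl K 3 2) = sbr K ↑A ↑B → (AC : gl K 3 2) = sbr K ↑A ↑C →
    (BC : gl K 3 2) = sbr K ↑B ↑C →
    sg K (p * pA) • Matrix.mulVec (A : gl K 3 2) (f B C)
      - sg K (pA * pB + p * pB) • Matrix.mulVec (B : gl K 3 2) (f A C)
      + sg K ((pA + pB) * pC + p * pC) • Matrix.mulVec (C : gl K 3 2) (f A B)
      - f AB C + sg K (pB * pC) • f AC B + f A BC = 0

/-- The 2-coboundary condition for the vector module. -/
def IsCoboundaryVec (p : ZMod 2) (f : ↥(sl K 3 2) →ₗ[K] ↥(sl K 3 2) →ₗ[K] M5 K) : Prop :=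
  ∃ φ : ↥(sl K 3 2) →ₗ[K] M5 K,
    (∀ (q : ZMod 2) (A : ↥(sl K 3 2)), IsHom K q (A : gl K 3 2) → φ A ∈ Mpart K (q + p)) ∧
    ∀ (pA pB : ZMod 2) (A B AB : ↥(sl K 3 2)),
      IsHom K pA (A : gl K 3 2) → IsHom K pB (B : gl K 3 2) →
      (AB : gl K 3 2) = sbr K ↑A ↑B →
      f A B = sg K (p * pA) • Matrix.mulVec (A : gl K 3 2) (φ B)
        - sg K (pA * pB + p * pB) • Matrix.mulVec (B : gl K 3 2) (φ A) - φ AB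

/-- The action of a homogeneous `A` of parity `pA` on a homogeneous element `λ` of parity
`q` of the graded dual (covector) module: `(A·λ)(v) = -(-1)^{|A||λ|} λ(Av)`. -/
def dAct (pA : ZMod 2) (A : ↥(sl K 3 2)) (q : ZMod 2) (l : M5 K) : M5 K :=
  -(sg K (pA * q) • Matrix.vecMul l (A : gl K 3 2))

/-- The 2-cocycle condition for the covector module `M*`. -/
def IsCocycleDual (p : ZMod 2) (f : ↥(sl K 3 2) →ₗ[K] ↥(sl K 3 2) →ₗ[K] M5 K) : Prop :=
  ∀ (pA pB pC : ZMod 2) (A B C AB AC BC : ↥(sl K 3 2)),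
    IsHom K pA (A : gl K 3 2) → IsHom K pB (B : gl K 3 2) → IsHom K pC (C : gl K 3 2) →
    (AB : gl K 3 2) = sbr K ↑A ↑B → (AC : gl K 3 2) = sbr K ↑A ↑C →
    (BC : gl K 3 2) = sbr K ↑B ↑C →
    sg K (p * pA) • dAct K pA A (pB + pC + p) (f B C)
      - sg K (pA * pB + p * pB) • dAct K pB B (pA + pC + p) (f A C)
      + sg K ((pA + pB) * pC + p * pC) • dAct K pC C (pA + pB + p) (f A B)
      - f AB C + sg K (pB * pC) • f AC B + f A BC = 0

/-- The 2-coboundary condition for the covector module. -/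
def IsCoboundaryDual (p : ZMod 2) (f : ↥(sl K 3 2) →ₗ[K] ↥(sl K 3 2) →ₗ[K] M5 K) : Prop :=
  ∃ φ : ↥(sl K 3 2) →ₗ[K] M5 K,
    (∀ (q : ZMod 2) (A : ↥(sl K 3 2)), IsHom K q (A : gl K 3 2) → φ A ∈ Mpart K (q + p)) ∧
    ∀ (pA pB : ZMod 2) (A B AB : ↥(sl K 3 2)),
      IsHom K pA (A : gl K 3 2) → IsHom K pB (B : gl K 3 2) →
      (AB : gl K 3 2) = sbr K ↑A ↑B →
      f A B = sg K (p * pA) • dAct K pA A (pB + p) (φ B)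
        - sg K (pA * pB + p * pB) • dAct K pB B (pA + p) (φ A) - φ AB

/-- The eigenvalues of the central element `diag(2,2,2,3,3)` of the even part of `sl(3|2)`. -/
def wt (i : Fin (3 + 2)) : ℤ := if (i : ℕ) < 3 then 2 else 3

/-- `A` is an eigenvector of eigenvalue `s` for bracketing with `diag(2,2,2,3,3)`. -/
def HasWt (s : ℤ) (A : gl K 3 2) : Prop := ∀ i j, A i j ≠ 0 → wt i - wt j = s

@[simp] lemma wt_castAdd (i : Fin 3) : wt (Fin.castAdd 2 i) = 2 := by
  simp [wt]

@[simp] lemma wt_natAdd (a : Fin 2) : wt (Fin.natAdd 3 a) = 3 := by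
  simp [wt]

@[simp] lemma par_castAdd (i : Fin 3) : par 3 2 (Fin.castAdd 2 i) = 0 := by
  simp [par]

@[simp] lemma par_natAdd (a : Fin 2) : par 3 2 (Fin.natAdd 3 a) = 1 := by
  simp [par]

lemma wt_sub_wt (i j : Fin (3 + 2)) :
    wt i - wt j = -1 ∨ wt i - wt j = 0 ∨ wt i - wt j = 1 := by
  unfold wt
  split_ifs <;> simp

lemma mem_Mpart {p : ZMod 2} {x : M5 K} : x ∈ Mpart K p ↔ ∀ i, par 3 2 i ≠ p → x i = 0 := by
  simp only [Mpart, Submodule.mem_pi, Set.mem_univ, true_implies]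
  refine forall_congr' fun i => ?_
  split_ifs with h <;> simp [h]

lemma mem_sl {A : gl K 3 2} : A ∈ sl K 3 2 ↔ str K A = 0 := Iff.rfl

variable {K}

lemma HasWt.eq_zero {s : ℤ} {A : gl K 3 2} (h : HasWt K s A) (h₁ : s ≠ -1) (h₂ : s ≠ 0)
    (h₃ : s ≠ 1) : A = 0 := by
  ext i j
  by_contra hij
  have := h i j hij
  have := wt_sub_wt i j
  simp_all

lemma HasWt.mul {s t : ℤ} {A B : gl K 3 2} (hA : HasWt K s A) (hB : HasWt K t B) :
    HasWt K (s + t) (A * B) := by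
  intro i j h
  rw [Matrix.mul_apply] at h
  obtain ⟨k, -, hk⟩ := Finset.exists_ne_zero_of_sum_ne_zero h
  have h₁ := hA i k (left_ne_zero_of_mul hk)
  have h₂ := hB k j (right_ne_zero_of_mul hk)
  linarith

lemma HasWt.add {s : ℤ} {A B : gl K 3 2} (hA : HasWt K s A) (hB : HasWt K s B) :
    HasWt K s (A + B) := by
  intro i j h
  by_cases h₁ : A i j = 0
  · exact hB i j (by simpa [h₁] using h)
  · exact hA i j h₁

lemma HasWt.neg {s : ℤ} {A : gl K 3 2} (hA : HasWt K s A) : HasWt K s (-A) :=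
  fun i j h => hA i j (by simpa using h)

lemma HasWt.evenP {s : ℤ} {A : gl K 3 2} (hA : HasWt K s A) : HasWt K s (evenP K A) :=
  fun i j h => hA i j (by
    simp only [_root_.evenP, Matrix.of_apply] at h
    split_ifs at h <;> simp_all)

lemma HasWt.oddP {s : ℤ} {A : gl K 3 2} (hA : HasWt K s A) : HasWt K s (oddP K A) :=
  fun i j h => hA i j (by
    simp only [_root_.oddP, Matrix.of_apply] at h
    split_ifs at h <;> simp_all)

lemma HasWt.sbr {s t : ℤ} {A B : gl K 3 2} (hA : HasWt K s A) (hB : HasWt K t B) :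
    HasWt K (s + t) (sbr K A B) := by
  have h₁ := hB.evenP.mul hA
  have h₂ := hB.oddP.mul hA.evenP
  have h₃ := hB.oddP.mul hA.oddP
  rw [add_comm] at h₁ h₂ h₃
  simp only [_root_.sbr, sub_eq_add_neg]
  exact (((hA.mul hB).add h₁.neg).add h₂.neg).add h₃

lemma evenP_eq {A : gl K 3 2} (h : IsHom K 0 A) : evenP K A = A := by
  ext i j
  have := h i j
  simp only [evenP, Matrix.of_apply, CharTwo.add_eq_zero] at *
  split_ifs <;> tauto

lemma oddP_eq_zero {A : gl K 3 2} (h : IsHom K 0 A) : oddP K A = 0 := by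
  ext i j
  have := h i j
  simp only [oddP, Matrix.of_apply, CharTwo.add_eq_zero, Matrix.zero_apply] at *
  split_ifs <;> tauto

lemma evenP_eq_zero {A : gl K 3 2} (h : IsHom K 1 A) : evenP K A = 0 := by
  ext i j
  have := h i j
  simp only [evenP, Matrix.of_apply, Matrix.zero_apply] at *
  split_ifs with hij
  · rw [hij, CharTwo.add_self_eq_zero] at this
    by_contra h0
    exact zero_ne_one (this h0)
  · rfl

lemma oddP_eq {A : gl K 3 2} (h : IsHom K 1 A) : oddP K A = A := by
  ext i j
  have := h i j
  simp only [oddP, Matrix.of_apply] at *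
  split_ifs with hij
  · rw [hij, CharTwo.add_self_eq_zero] at this
    by_contra h0
    exact zero_ne_one (this (Ne.symm h0))
  · rfl

lemma ZMod.eq_zero_or_eq_one (p : ZMod 2) : p = 0 ∨ p = 1 := by
  revert p
  decide

lemma sbr_eq {p q : ZMod 2} {A B : gl K 3 2} (hA : IsHom K p A) (hB : IsHom K q B) :
    sbr K A B = A * B - sg K (p * q) • (B * A) := by
  obtain rfl | rfl := ZMod.eq_zero_or_eq_one p <;> obtain rfl | rfl := ZMod.eq_zero_or_eq_one q <;>
  simp [sbr, sg, evenP_eq, oddP_eq, evenP_eq_zero, oddP_eq_zero, hA, hB]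

lemma str_sbr (A B : gl K 3 2) : str K (sbr K A B) = 0 := by
  simp [str, sbr, sg, par, Fin.sum_univ_succ, Matrix.mul_apply, evenP, oddP]
  ring

variable (K) in
/-- The super bracket as a bilinear map on `sl(3|2)`. -/
def slBracket : sl K 3 2 →ₗ[K] sl K 3 2 →ₗ[K] sl K 3 2 :=
  LinearMap.mk₂ K (fun A B => ⟨sbr K A B, str_sbr _ _⟩)
    (fun A A' B => by
      ext i j
      simp only [sbr, evenP, oddP, Matrix.mul_apply, Matrix.add_apply, Matrix.sub_apply,
        Submodule.coe_add, Matrix.of_apply, ← Finset.sum_add_distrib, ← Finset.sum_sub_distrib]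
      refine Finset.sum_congr rfl fun k _ => ?_
      split_ifs <;> ring)
    (fun c A B => by
      ext i j
      simp only [sbr, evenP, oddP, Matrix.mul_apply, Matrix.add_apply, Matrix.sub_apply,
        Submodule.coe_smul, Matrix.smul_apply, smul_eq_mul, Matrix.of_apply, Finset.mul_sum,
        ← Finset.sum_add_distrib, ← Finset.sum_sub_distrib]
      refine Finset.sum_congr rfl fun k _ => ?_
      split_ifs <;> ring)
    (fun A B B' => by
      ext i j
      simp only [sbr, evenP, oddP, Matrix.mul_apply, Matrix.add_apply, Matrix.sub_apply,
        Submodule.coe_add, Matrix.of_apply, ← Finset.sum_add_distrib, ← Finset.sum_sub_distrib]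
      refine Finset.sum_congr rfl fun k _ => ?_
      split_ifs <;> ring)
    (fun c A B => by
      ext i j
      simp only [sbr, evenP, oddP, Matrix.mul_apply, Matrix.add_apply, Matrix.sub_apply,
        Submodule.coe_smul, Matrix.smul_apply, smul_eq_mul, Matrix.of_apply, Finset.mul_sum,
        ← Finset.sum_add_distrib, ← Finset.sum_sub_distrib]
      refine Finset.sum_congr rfl fun k _ => ?_
      split_ifs <;> ring)

@[simp] lemma coe_slBracket (A B : sl K 3 2) : (slBracket K A B : gl K 3 2) = sbr K A B := rfl

variable (K) in
/-- The projection of `sl(3|2)` onto its weight-`s` part. -/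
def wtProj (s : ℤ) : sl K 3 2 →ₗ[K] sl K 3 2 where
  toFun A := ⟨Matrix.of fun i j => if wt i - wt j = s then (A : gl K 3 2) i j else 0, by
    have hA : str K (A : gl K 3 2) = 0 := A.2
    rw [mem_sl]
    by_cases hs : 0 = s <;> simp_all [str]⟩
  map_add' A B := by
    ext i j
    simp only [Submodule.coe_add, Matrix.of_apply, Matrix.add_apply]
    split_ifs <;> simp
  map_smul' c A := by
    ext i j
    simp

lemma wtProj_apply (s : ℤ) (A : sl K 3 2) (i j) :
    (wtProj K s A : gl K 3 2) i j = if wt i - wt j = s then (A : gl K 3 2) i j else 0 := rfl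

lemma hasWt_wtProj (s : ℤ) (A : sl K 3 2) : HasWt K s (wtProj K s A : gl K 3 2) := by
  intro i j h
  rw [wtProj_apply] at h
  split_ifs at h <;> tauto

lemma IsHom.wtProj {p : ZMod 2} {A : sl K 3 2} (hA : IsHom K p (A : gl K 3 2)) (s : ℤ) :
    IsHom K p (wtProj K s A : gl K 3 2) := by
  intro i j h
  rw [wtProj_apply] at h
  split_ifs at h
  · exact hA i j h
  · tauto

lemma HasWt.wtProj {s t : ℤ} {A : sl K 3 2} (hA : HasWt K t (A : gl K 3 2)) :
    wtProj K s A = if s = t then A else 0 := by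
  ext i j
  rw [wtProj_apply]
  by_cases h : (A : gl K 3 2) i j = 0
  · split_ifs <;> simp [h]
  · rw [hA i j h]
    by_cases hst : s = t
    · simp [hst]
    · simp [hst, Ne.symm hst]

lemma wtProj_add_wtProj_add_wtProj (A : sl K 3 2) :
    wtProj K (-1) A + wtProj K 0 A + wtProj K 1 A = A := by
  ext i j
  simp only [Submodule.coe_add, Matrix.add_apply, wtProj_apply]
  rcases wt_sub_wt i j with h | h | h <;> simp [h]

lemma bilin_eq_zero_of_wtProj {D : sl K 3 2 →ₗ[K] sl K 3 2 →ₗ[K] M5 K} {A B : sl K 3 2}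
    (h : ∀ s t, D (wtProj K s A) (wtProj K t B) = 0) : D A B = 0 := by
  rw [← wtProj_add_wtProj_add_wtProj A, ← wtProj_add_wtProj_add_wtProj B]
  simp [h]

variable (K) in
/-- The central element `diag(2,2,2,3,3)` of the even part of `sl(3|2)`. -/
def slCenter : sl K 3 2 :=
  ⟨Matrix.diagonal fun i => (wt i : K), by
    rw [mem_sl]
    unfold str
    rw [Fin.sum_univ_add]
    simp [sg]
    norm_num⟩

lemma isHom_slCenter : IsHom K 0 (slCenter K : gl K 3 2) := by
  intro i j h
  obtain rfl : i = j := by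
    by_contra hij
    exact h (Matrix.diagonal_apply_ne _ hij)
  exact CharTwo.add_self_eq_zero _

lemma slBracket_slCenter {p : ZMod 2} {s : ℤ} {A : sl K 3 2} (hp : IsHom K p (A : gl K 3 2))
    (hA : HasWt K s (A : gl K 3 2)) : slBracket K (slCenter K) A = (s : K) • A := by
  ext i j
  rw [coe_slBracket, sbr_eq isHom_slCenter hp]
  by_cases h : (A : gl K 3 2) i j = 0
  · simp [slCenter, h]
  · simp [slCenter, sg, ← hA i j h]
    ring

/-- The cocycle condition for a family of bilinear maps `ρ pA q`, read as the action of elements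
of parity `pA` on vectors of parity `q`. -/
def IsCocycleFor (ρ : ZMod 2 → ZMod 2 → sl K 3 2 →ₗ[K] M5 K →ₗ[K] M5 K) (p : ZMod 2)
    (f : sl K 3 2 →ₗ[K] sl K 3 2 →ₗ[K] M5 K) : Prop :=
  ∀ (pA pB pC : ZMod 2) (A B C AB AC BC : sl K 3 2),
    IsHom K pA (A : gl K 3 2) → IsHom K pB (B : gl K 3 2) → IsHom K pC (C : gl K 3 2) →
    (AB : gl K 3 2) = sbr K ↑A ↑B → (AC : gl K 3 2) = sbr K ↑A ↑C →
    (BC : gl K 3 2) = sbr K ↑B ↑C →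
    sg K (p * pA) • ρ pA (pB + pC + p) A (f B C)
      - sg K (pA * pB + p * pB) • ρ pB (pA + pC + p) B (f A C)
      + sg K ((pA + pB) * pC + p * pC) • ρ pC (pA + pB + p) C (f A B)
      - f AB C + sg K (pB * pC) • f AC B + f A BC = 0

/-- The coboundary condition for a family of bilinear maps `ρ pA q`, read as the action of elements
of parity `pA` on vectors of parity `q`. -/
def IsCoboundaryFor (ρ : ZMod 2 → ZMod 2 → sl K 3 2 →ₗ[K] M5 K →ₗ[K] M5 K) (p : ZMod 2)
    (f : sl K 3 2 →ₗ[K] sl K 3 2 →ₗ[K] M5 K) : Prop :=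
  ∃ φ : sl K 3 2 →ₗ[K] M5 K,
    (∀ (q : ZMod 2) (A : sl K 3 2), IsHom K q (A : gl K 3 2) → φ A ∈ Mpart K (q + p)) ∧
    ∀ (pA pB : ZMod 2) (A B AB : sl K 3 2),
      IsHom K pA (A : gl K 3 2) → IsHom K pB (B : gl K 3 2) →
      (AB : gl K 3 2) = sbr K ↑A ↑B →
      f A B = sg K (p * pA) • ρ pA (pB + p) A (φ B)
        - sg K (pA * pB + p * pB) • ρ pB (pA + p) B (φ A) - φ AB

lemma int_sub_ne_zero_of_wt {σ : ℤ} (hσ : σ = 1 ∨ σ = -1) (i : Fin (3 + 2)) {s : ℤ}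
    (hs : s = -1 ∨ s = 0 ∨ s = 1) : σ * wt i - s ≠ 0 := by
  unfold wt
  rcases hσ with rfl | rfl <;> split_ifs <;> omega

/-- The contraction of `f` with `diag(2,2,2,3,3)`, each weight component being divided by its
weight, when vectors have weights `σ * wt i`. -/
def contraction (σ : ℤ) (f : sl K 3 2 →ₗ[K] sl K 3 2 →ₗ[K] M5 K) : sl K 3 2 →ₗ[K] M5 K :=
  LinearMap.pi fun i => ∑ s ∈ ({-1, 0, 1} : Finset ℤ),
    ((σ * wt i - s : ℤ) : K)⁻¹ • (LinearMap.proj i ∘ₗ f (slCenter K) ∘ₗ wtProj K s)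

lemma contraction_apply (σ : ℤ) (f : sl K 3 2 →ₗ[K] sl K 3 2 →ₗ[K] M5 K) (A : sl K 3 2) (i) :
    contraction σ f A i = ∑ s ∈ ({-1, 0, 1} : Finset ℤ),
      ((σ * wt i - s : ℤ) : K)⁻¹ * f (slCenter K) (wtProj K s A) i := by
  simp [contraction]

lemma contraction_mem {σ : ℤ} {p : ZMod 2} {f : sl K 3 2 →ₗ[K] sl K 3 2 →ₗ[K] M5 K}
    (hf : IsCochain32 K p f) {q : ZMod 2} {A : sl K 3 2} (hA : IsHom K q (A : gl K 3 2)) :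
    contraction σ f A ∈ Mpart K (q + p) := by
  rw [mem_Mpart]
  intro i hi
  rw [contraction_apply]
  refine Finset.sum_eq_zero fun s _ => ?_
  have := hf.1 0 q (slCenter K) _ isHom_slCenter (hA.wtProj s)
  rw [zero_add, mem_Mpart] at this
  rw [this i hi, mul_zero]

lemma mul_contraction [CharZero K] {σ : ℤ} (hσ : σ = 1 ∨ σ = -1)
    (f : sl K 3 2 →ₗ[K] sl K 3 2 →ₗ[K] M5 K) {t : ℤ} {A : sl K 3 2}
    (hA : HasWt K t (A : gl K 3 2)) (i) :
    f (slCenter K) A i = ((σ * wt i - t : ℤ) : K) * contraction σ f A i := by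
  by_cases ht : t = -1 ∨ t = 0 ∨ t = 1
  · rw [contraction_apply, Finset.sum_eq_single t]
    · rw [hA.wtProj, if_pos rfl, mul_inv_cancel_left₀]
      exact Int.cast_ne_zero.2 (int_sub_ne_zero_of_wt hσ i ht)
    · intro s _ hst
      simp [hA.wtProj, hst]
    · intro h
      simp at h
      tauto
  · push Not at ht
    obtain rfl : A = 0 := Subtype.ext (hA.eq_zero ht.1 ht.2.1 ht.2.2)
    simp

/-- Cartan's homotopy formula for `diag(2,2,2,3,3)`. -/
lemma weight_mul_eq_coboundary [CharZero K] {σ : ℤ} (hσ : σ = 1 ∨ σ = -1)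
    {ρ : ZMod 2 → ZMod 2 → sl K 3 2 →ₗ[K] M5 K →ₗ[K] M5 K}
    (hz : ∀ q l i, ρ 0 q (slCenter K) l i = ((σ * wt i : ℤ) : K) * l i)
    (hρ : ∀ (p q : ZMod 2) (A : sl K 3 2) (s t : ℤ) (l l' : M5 K), HasWt K s (A : gl K 3 2) →
      (∀ i, l i = ((σ * wt i - t : ℤ) : K) * l' i) →
      ∀ i, ρ p q A l i = ((σ * wt i - (s + t) : ℤ) : K) * ρ p q A l' i)
    {p : ZMod 2} {f : sl K 3 2 →ₗ[K] sl K 3 2 →ₗ[K] M5 K}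
    (hf : IsCochain32 K p f) (hc : IsCocycleFor ρ p f) {pA pB : ZMod 2} {A B : sl K 3 2}
    (hA : IsHom K pA (A : gl K 3 2)) (hB : IsHom K pB (B : gl K 3 2)) {s t : ℤ}
    (hs : HasWt K s (A : gl K 3 2)) (ht : HasWt K t (B : gl K 3 2)) (i) :
    ((σ * wt i - (s + t) : ℤ) : K) * f A B i = ((σ * wt i - (s + t) : ℤ) : K) *
      (sg K (p * pA) • ρ pA (pB + p) A (contraction σ f B)
        - sg K (pA * pB + p * pB) • ρ pB (pA + p) B (contraction σ f A)
        - contraction σ f (slBracket K A B)) i := by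
  have h₁ := congrFun (hc 0 pA pB (slCenter K) A B _ _ (slBracket K A B) isHom_slCenter hA hB
    (congrArg Subtype.val (slBracket_slCenter hA hs).symm)
    (congrArg Subtype.val (slBracket_slCenter hB ht).symm) rfl) i
  have h₂ := congrFun (hf.2 pA pB A B hA hB) i
  have h₃ := hρ pA (pB + p) A s t _ _ hs (mul_contraction hσ f ht) i
  have h₄ := hρ pB (pA + p) B t s _ _ ht (mul_contraction hσ f hs) i
  have h₅ := mul_contraction hσ f (A := slBracket K A B) (hs.sbr ht) i
  have h₆ : sg K (pA * pB) * sg K (pA * pB) = 1 := by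
    unfold sg
    split_ifs <;> simp
  simp only [map_smul, LinearMap.smul_apply, Pi.add_apply, Pi.sub_apply, Pi.smul_apply,
    Pi.neg_apply, smul_eq_mul, hz, h₂, h₅, zero_add, mul_zero, zero_mul, Pi.zero_apply,
    h₃, h₄] at h₁ ⊢
  simp only [sg, if_true] at h₁ h₆ ⊢
  push_cast at h₁ ⊢
  linear_combination h₁ + (t : K) * f A B i * h₆

theorem exists_coboundary [CharZero K] {σ : ℤ} (hσ : σ = 1 ∨ σ = -1)
    {ρ : ZMod 2 → ZMod 2 → sl K 3 2 →ₗ[K] M5 K →ₗ[K] M5 K}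
    (hz : ∀ q l i, ρ 0 q (slCenter K) l i = ((σ * wt i : ℤ) : K) * l i)
    (hρ : ∀ (p q : ZMod 2) (A : sl K 3 2) (s t : ℤ) (l l' : M5 K), HasWt K s (A : gl K 3 2) →
      (∀ i, l i = ((σ * wt i - t : ℤ) : K) * l' i) →
      ∀ i, ρ p q A l i = ((σ * wt i - (s + t) : ℤ) : K) * ρ p q A l' i)
    (htop : ∀ (p q : ZMod 2) (A : sl K 3 2) (l : M5 K), HasWt K σ (A : gl K 3 2) →
      ∀ i, wt i = 2 → ρ p q A l i = 0)
    {p : ZMod 2} {f g : sl K 3 2 →ₗ[K] sl K 3 2 →ₗ[K] M5 K}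
    (hf : IsCochain32 K p f) (hc : IsCocycleFor ρ p f)
    (hg : ∀ (s t : ℤ) (A B : sl K 3 2), HasWt K s (A : gl K 3 2) → HasWt K t (B : gl K 3 2) →
      ∀ i, g A B i ≠ 0 → σ * wt i = s + t)
    {c : K} (hfg : ∀ A B : sl K 3 2, HasWt K σ (A : gl K 3 2) → HasWt K σ (B : gl K 3 2) →
      ∀ i, wt i = 2 → f A B i = c * g A B i) :
    IsCoboundaryFor ρ p (f - c • g) := by
  refine ⟨contraction σ f, fun q A hA => contraction_mem hf hA, fun pA pB A B AB hA hB hAB => ?_⟩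
  obtain rfl : AB = slBracket K A B := Subtype.ext hAB
  let φ := contraction σ f
  let D : sl K 3 2 →ₗ[K] sl K 3 2 →ₗ[K] M5 K := f - c • g
    - (sg K (p * pA) • (ρ pA (pB + p)).compl₂ φ
      - sg K (pA * pB + p * pB) • ((ρ pB (pA + p)).compl₂ φ).flip - (slBracket K).compr₂ φ)
  have hD : D A B = 0 := by
    refine bilin_eq_zero_of_wtProj fun s t => ?_
    have hs := hasWt_wtProj s A
    have ht := hasWt_wtProj t B
    have hA' := hA.wtProj s
    have hB' := hB.wtProj t
    generalize wtProj K s A = A at *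
    generalize wtProj K t B = B at *
    ext i
    have key := weight_mul_eq_coboundary hσ hz hρ hf hc hA' hB' hs ht i
    simp only [D, φ, LinearMap.sub_apply, LinearMap.smul_apply, LinearMap.compl₂_apply,
      LinearMap.flip_apply, LinearMap.compr₂_apply]
    simp only [Pi.sub_apply (_ - _), Pi.zero_apply]
    rw [Pi.sub_apply, sub_eq_zero]
    by_cases h : σ * wt i = s + t
    · by_cases hA0 : A = 0
      · simp [hA0]
      by_cases hB0 : B = 0
      · simp [hB0]
      have hs' : s = -1 ∨ s = 0 ∨ s = 1 := by
        by_contra h'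
        push Not at h'
        exact hA0 (Subtype.ext (hs.eq_zero h'.1 h'.2.1 h'.2.2))
      have ht' : t = -1 ∨ t = 0 ∨ t = 1 := by
        by_contra h'
        push Not at h'
        exact hB0 (Subtype.ext (ht.eq_zero h'.1 h'.2.1 h'.2.2))
      have hi : wt i = 2 ∨ wt i = 3 := by
        unfold wt
        split_ifs <;> simp
      have hall : s = σ ∧ t = σ ∧ wt i = 2 := by
        rcases hσ with rfl | rfl <;> omega
      obtain ⟨rfl, rfl, hi⟩ := hall
      have hAB : slBracket K A B = 0 :=
        Subtype.ext ((hs.sbr ht).eq_zero (by omega) (by omega) (by omega))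
      simp [hAB, htop _ _ _ _ hs i hi, htop _ _ _ _ ht i hi, hfg A B hs ht i hi]
    · have hg0 : g A B i = 0 := by
        by_contra h'
        exact h (hg s t A B hs ht i h')
      have h' := mul_left_cancel₀ (Int.cast_ne_zero.2 (sub_ne_zero.2 h)) key
      simp only [Pi.sub_apply] at h'
      simp [h', hg0]
  exact sub_eq_zero.1 hD

lemma sum_mul_eq_crossProduct {F : Fin 2 → Fin 2 → Fin 3 → Fin 3 → Fin 3 → K}
    (h3 : ∀ l m, l ≠ m → ∀ a b i j k, (if k = l then F a b i j m else 0)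
      + (if i = l then F a b m j k else 0) + (if j = l then F a b i m k else 0) = 0)
    (h2 : ∀ c d, c ≠ d → ∀ a b i j k,
      (if a = d then F c b i j k else 0) + (if b = d then F a c i j k else 0) = 0)
    (x y : Fin 2 → Fin 3 → K) (k : Fin 3) :
    ∑ a, ∑ i, ∑ b, ∑ j, x a i * y b j * F a b i j k
      = F 0 1 0 1 2 * (x 0 ⨯₃ y 1 - x 1 ⨯₃ y 0) k := by
  have hz : ∀ l m a b j k, l ≠ m → l ≠ j → l ≠ k → F a b m j k = 0 := by
    intro l m a b j k h₁ h₂ h₃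
    simpa [h₂.symm, h₃.symm] using h3 l m h₁ a b l j k
  have hik : ∀ l m a b j, l ≠ m → l ≠ j → F a b m j l = - F a b l j m := by
    intro l m a b j h₁ h₂
    have := h3 l m h₁ a b l j l
    simp only [if_true, h₂.symm, if_false, add_zero] at this
    linear_combination this
  have hij : ∀ l m a b k, l ≠ m → l ≠ k → F a b m l k = - F a b l m k := by
    intro l m a b j h₁ h₂
    have := h3 l m h₁ a b l l j
    simp only [if_true, h₂.symm, if_false, zero_add] at this
    linear_combination this
  have haa : ∀ c d i j k, c ≠ d → F c c i j k = 0 := by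
    intro c d i j k h
    simpa [h] using h2 c d h c d i j k
  have hab : ∀ i j k, F 1 0 i j k = - F 0 1 i j k := by
    intro i j k
    have := h2 0 1 (by decide) 1 1 i j k
    simp only [if_true] at this
    linear_combination this
  have e₁ := fun i j k => haa 0 1 i j k (by decide)
  have e₂ := fun i j k => haa 1 0 i j k (by decide)
  have z₀ := fun j k => hz 0 1 0 1 j k (by decide)
  have z₁ := fun j k => hz 0 2 0 1 j k (by decide)
  have z₂ := fun j k => hz 1 0 0 1 j k (by decide)
  have z₃ := fun j k => hz 1 2 0 1 j k (by decide)
  have z₄ := fun j k => hz 2 0 0 1 j k (by decide)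
  have z₅ := fun j k => hz 2 1 0 1 j k (by decide)
  have f₁ := hij 0 1 0 1 2 (by decide) (by decide)
  have f₂ := hik 0 2 0 1 1 (by decide) (by decide)
  have f₃ := hij 0 2 0 1 1 (by decide) (by decide)
  have f₄ := hik 1 2 0 1 0 (by decide) (by decide)
  have f₅ := hij 1 2 0 1 0 (by decide) (by decide)
  fin_cases k <;>
  simp [Fin.sum_univ_two, Fin.sum_univ_three, cross_apply, e₁, e₂, hab, z₀, z₁, z₂, z₃, z₄, z₅]
  all_goals grind

lemma HasWt.isHom_one {σ : ℤ} (hσ : σ = 1 ∨ σ = -1) {A : gl K 3 2} (hA : HasWt K σ A) :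
    IsHom K 1 A := by
  intro i j h
  have hij := hA i j h
  have h_odd : ∀ i j, wt i - wt j = 1 ∨ wt i - wt j = -1 → par 3 2 i + par 3 2 j = 1 := by
    decide
  exact h_odd i j (hij ▸ hσ)

/-- The component of weight `2σ` of a cocycle is invariant under the even part of `sl(3|2)`. -/
lemma top_invariant {σ : ℤ} (hσ : σ = 1 ∨ σ = -1)
    {ρ : ZMod 2 → ZMod 2 → sl K 3 2 →ₗ[K] M5 K →ₗ[K] M5 K}
    (htop : ∀ (p q : ZMod 2) (A : sl K 3 2) (l : M5 K), HasWt K σ (A : gl K 3 2) →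
      ∀ i, wt i = 2 → ρ p q A l i = 0)
    {p : ZMod 2} {f : sl K 3 2 →ₗ[K] sl K 3 2 →ₗ[K] M5 K}
    (hf : IsCochain32 K p f) (hc : IsCocycleFor ρ p f) {X A B : sl K 3 2}
    (hX : IsHom K 0 (X : gl K 3 2))
    (hXB : HasWt K σ (slBracket K X B : gl K 3 2)) (hA : HasWt K σ (A : gl K 3 2))
    (hB : HasWt K σ (B : gl K 3 2)) {i} (hi : wt i = 2) :
    ρ 0 p X (f A B) i = f (slBracket K X A) B i + f A (slBracket K X B) i := by
  have h₁ := congrFun (hc 0 1 1 X A B _ _ _ hX (hA.isHom_one hσ) (hB.isHom_one hσ)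
    (coe_slBracket X A) (coe_slBracket X B) (coe_slBracket A B)) i
  have h₂ := congrFun (hf.2 1 1 A _ (hA.isHom_one hσ) (hXB.isHom_one hσ)) i
  have h₃ : slBracket K A B = 0 :=
    Subtype.ext ((hA.sbr hB).eq_zero (by omega) (by omega) (by omega))
  have h₄ : (1 : ZMod 2) + 1 = 0 := rfl
  simp only [h₃, h₄, Pi.add_apply, Pi.sub_apply, Pi.smul_apply, Pi.neg_apply, map_zero,
    Pi.zero_apply, htop _ _ _ _ hA i hi, htop _ _ _ _ hB i hi, mul_zero, mul_one, zero_add, h₂,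
    smul_eq_mul, sg, if_true, one_ne_zero, if_false] at h₁
  linear_combination h₁

variable (K) in
/-- The pairing `(A, B) ↦ x A 0 × x B 1 - x A 1 × x B 0` with values in the even part of `𝕂⁵`. -/
def crossForm (x : sl K 3 2 →ₗ[K] Fin 2 → Fin 3 → K) : sl K 3 2 →ₗ[K] sl K 3 2 →ₗ[K] M5 K :=
  LinearMap.mk₂ K (fun A B => Fin.append (x A 0 ⨯₃ x B 1 - x A 1 ⨯₃ x B 0) 0)
    (fun A A' B => by
      ext i
      refine Fin.addCases (fun k => ?_) (fun a => ?_) i <;> simp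
      ring)
    (fun c A B => by
      ext i
      refine Fin.addCases (fun k => ?_) (fun a => ?_) i <;> simp
      ring)
    (fun A B B' => by
      ext i
      refine Fin.addCases (fun k => ?_) (fun a => ?_) i <;> simp
      ring)
    (fun c A B => by
      ext i
      refine Fin.addCases (fun k => ?_) (fun a => ?_) i <;> simp
      ring)

lemma crossForm_apply (x : sl K 3 2 →ₗ[K] Fin 2 → Fin 3 → K) (A B : sl K 3 2) :
    crossForm K x A B = Fin.append (x A 0 ⨯₃ x B 1 - x A 1 ⨯₃ x B 0) 0 := rfl

@[simp] lemma crossForm_castAdd (x : sl K 3 2 →ₗ[K] Fin 2 → Fin 3 → K) (A B : sl K 3 2) (k) :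
    crossForm K x A B (Fin.castAdd 2 k) = (x A 0 ⨯₃ x B 1 - x A 1 ⨯₃ x B 0) k := by
  rw [crossForm_apply, Fin.append_left]

@[simp] lemma crossForm_natAdd (x : sl K 3 2 →ₗ[K] Fin 2 → Fin 3 → K) (A B : sl K 3 2) (a) :
    crossForm K x A B (Fin.natAdd 3 a) = 0 := by
  rw [crossForm_apply, Fin.append_right, Pi.zero_apply]

lemma isCochain_crossForm {x : sl K 3 2 →ₗ[K] Fin 2 → Fin 3 → K}
    (hx : ∀ A : sl K 3 2, IsHom K 0 (A : gl K 3 2) → x A = 0) :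
    IsCochain32 K 0 (crossForm K x) := by
  constructor
  · intro p q A B hA hB
    rw [mem_Mpart]
    intro i
    refine Fin.addCases (fun k hk => ?_) (fun a _ => crossForm_natAdd x A B a) i
    obtain rfl | rfl := ZMod.eq_zero_or_eq_one p
    · simp [hx A hA]
    obtain rfl | rfl := ZMod.eq_zero_or_eq_one q
    · simp [hx B hB]
    exact absurd (par_castAdd k) hk
  · intro p q A B hA hB
    ext i
    refine Fin.addCases (fun k => ?_) (fun a => by simp) i
    obtain rfl | rfl := ZMod.eq_zero_or_eq_one p
    · simp [hx A hA]
    obtain rfl | rfl := ZMod.eq_zero_or_eq_one q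
    · simp [hx B hB]
    simp only [crossForm_castAdd, Pi.neg_apply, Pi.smul_apply]
    rw [← cross_anticomm (x A 0), ← cross_anticomm (x A 1)]
    simp only [sg, mul_one, one_ne_zero, if_false, Pi.sub_apply, Pi.neg_apply, smul_eq_mul]
    ring

/-- Uniqueness up to scalar and coboundaries of the cocycle `crossForm K x`, where `x` reads the
coordinates of the odd part of weight `σ` in the basis `e`. -/
theorem existsUnique_cocycle [CharZero K] {σ : ℤ} (hσ : σ = 1 ∨ σ = -1)
    {ρ : ZMod 2 → ZMod 2 → sl K 3 2 →ₗ[K] M5 K →ₗ[K] M5 K}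
    (hz : ∀ q l i, ρ 0 q (slCenter K) l i = ((σ * wt i : ℤ) : K) * l i)
    (hρ : ∀ (p q : ZMod 2) (A : sl K 3 2) (s t : ℤ) (l l' : M5 K), HasWt K s (A : gl K 3 2) →
      (∀ i, l i = ((σ * wt i - t : ℤ) : K) * l' i) →
      ∀ i, ρ p q A l i = ((σ * wt i - (s + t) : ℤ) : K) * ρ p q A l' i)
    (htop : ∀ (p q : ZMod 2) (A : sl K 3 2) (l : M5 K), HasWt K σ (A : gl K 3 2) →
      ∀ i, wt i = 2 → ρ p q A l i = 0)
    {x : sl K 3 2 →ₗ[K] Fin 2 → Fin 3 → K} {e : Fin 2 → Fin 3 → sl K 3 2}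
    (hx : ∀ (s : ℤ) (A : sl K 3 2), HasWt K s (A : gl K 3 2) → s ≠ σ → x A = 0)
    (hx0 : ∀ A : sl K 3 2, IsHom K 0 (A : gl K 3 2) → x A = 0)
    (he : ∀ a i, HasWt K σ (e a i : gl K 3 2))
    (hxe : ∀ a i b j, x (e a i) b j = if a = b ∧ i = j then 1 else 0)
    (hex : ∀ A : sl K 3 2, HasWt K σ (A : gl K 3 2) → A = ∑ a, ∑ i, x A a i • e a i)
    (h3 : ∀ l m, l ≠ m → ∃ X : sl K 3 2, IsHom K 0 (X : gl K 3 2) ∧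
      (∀ a i, slBracket K X (e a i) = if i = l then -e a m else 0) ∧
      ∀ q v k, ρ 0 q X v (Fin.castAdd 2 k) = if k = l then v (Fin.castAdd 2 m) else 0)
    (h2 : ∀ c d, c ≠ d → ∃ X : sl K 3 2, IsHom K 0 (X : gl K 3 2) ∧
      (∀ a i, slBracket K X (e a i) = if a = d then e c i else 0) ∧
      ∀ q v k, ρ 0 q X v (Fin.castAdd 2 k) = 0)
    (hcoc : IsCocycleFor ρ 0 (crossForm K x)) :
    ∃ (p₀ : ZMod 2) (g : sl K 3 2 →ₗ[K] sl K 3 2 →ₗ[K] M5 K),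
      IsCochain32 K p₀ g ∧ IsCocycleFor ρ p₀ g ∧ ¬ IsCoboundaryFor ρ p₀ g ∧
      ∀ (p : ZMod 2) (f : sl K 3 2 →ₗ[K] sl K 3 2 →ₗ[K] M5 K),
        IsCochain32 K p f → IsCocycleFor ρ p f →
        ∃ c : K, IsCoboundaryFor ρ p (f - c • g) := by
  refine ⟨0, crossForm K x, isCochain_crossForm hx0, hcoc, ?_, ?_⟩
  · rintro ⟨φ, -, hφ⟩
    have h0 : slBracket K (e 0 0) (e 1 1) = 0 :=
      Subtype.ext (((he 0 0).sbr (he 1 1)).eq_zero (by omega) (by omega) (by omega))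
    have h := congrFun (hφ 1 1 (e 0 0) (e 1 1) 0 ((he 0 0).isHom_one hσ) ((he 1 1).isHom_one hσ)
      (congrArg Subtype.val h0.symm)) (Fin.castAdd 2 2)
    rw [crossForm_castAdd] at h
    simp only [Pi.sub_apply, Pi.smul_apply, htop _ _ _ _ (he _ _) _ (wt_castAdd _), map_zero,
      Pi.zero_apply, smul_zero, sub_zero] at h
    simp [hxe, cross_apply] at h
  · intro p f hf hc
    let F a b i j k := f (e a i) (e b j) (Fin.castAdd 2 k)
    refine ⟨F 0 1 0 1 2, exists_coboundary hσ hz hρ htop hf hc ?_ ?_⟩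
    · intro s t A B hA hB i hi
      by_cases hs : s = σ
      · by_cases ht : t = σ
        · revert hi
          refine Fin.addCases (fun k _ => ?_) (fun a ha => ?_) i
          · rw [wt_castAdd, hs, ht]
            ring
          · exact absurd (crossForm_natAdd x A B a) ha
        · simp [crossForm_apply, hx t B hB ht] at hi
          revert hi
          refine Fin.addCases (fun k => ?_) (fun a => ?_) i <;> simp
      · simp [crossForm_apply, hx s A hA hs] at hi
        revert hi
        refine Fin.addCases (fun k => ?_) (fun a => ?_) i <;> simp
    · intro A B hA hB i
      refine Fin.addCases (fun k _ => ?_) (fun a ha => by simp at ha) i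
      rw [crossForm_castAdd, ← sum_mul_eq_crossProduct (F := F)]
      · conv_lhs => rw [hex A hA, hex B hB]
        simp only [Fin.sum_univ_two, Fin.sum_univ_three, map_add, map_smul, LinearMap.add_apply,
          LinearMap.smul_apply, Pi.add_apply, Pi.smul_apply, smul_eq_mul, F]
        ring
      · intro l m hlm a b i j k
        obtain ⟨X, hX, hXe, hXv⟩ := h3 l m hlm
        have hw : ∀ a i, HasWt K σ (slBracket K X (e a i) : gl K 3 2) := by
          intro a i
          rw [hXe]
          split_ifs
          · exact (he a m).neg
          · exact fun i j h => absurd rfl h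
        have := top_invariant hσ htop hf hc hX (hw b j) (he a i) (he b j) (wt_castAdd k)
        rw [hXe, hXe, hXv] at this
        simp only [F]
        split_ifs at this ⊢ <;>
        try simp only [map_zero, map_neg, LinearMap.zero_apply, LinearMap.neg_apply, Pi.zero_apply,
          Pi.neg_apply] at this
        all_goals linear_combination this
      · intro c d hcd a b i j k
        obtain ⟨X, hX, hXe, hXv⟩ := h2 c d hcd
        have hw : ∀ a i, HasWt K σ (slBracket K X (e a i) : gl K 3 2) := by
          intro a i
          rw [hXe]
          split_ifs
          · exact he c i
          · exact fun i j h => absurd rfl h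
        have := top_invariant hσ htop hf hc hX (hw b j) (he a i) (he b j) (wt_castAdd k)
        rw [hXe, hXe, hXv] at this
        simp only [F]
        split_ifs at this ⊢ <;>
        try simp only [map_zero, LinearMap.zero_apply, Pi.zero_apply] at this
        all_goals linear_combination -this

lemma IsHom.apply_castAdd_natAdd {A : gl K 3 2} (hA : IsHom K 0 A) (i a) :
    A (Fin.castAdd 2 i) (Fin.natAdd 3 a) = 0 := by
  by_contra h
  simpa using hA _ _ h

lemma IsHom.apply_natAdd_castAdd {A : gl K 3 2} (hA : IsHom K 0 A) (i a) :
    A (Fin.natAdd 3 a) (Fin.castAdd 2 i) = 0 := by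
  by_contra h
  simpa using hA _ _ h

lemma IsHom.apply_castAdd_castAdd {A : gl K 3 2} (hA : IsHom K 1 A) (i j) :
    A (Fin.castAdd 2 i) (Fin.castAdd 2 j) = 0 := by
  by_contra h
  simpa using hA _ _ h

lemma str_eq_zero (A : sl K 3 2) :
    ∑ i, (A : gl K 3 2) (Fin.castAdd 2 i) (Fin.castAdd 2 i)
      = ∑ a, (A : gl K 3 2) (Fin.natAdd 3 a) (Fin.natAdd 3 a) := by
  have h : str K (A : gl K 3 2) = 0 := A.2
  unfold str at h
  rw [Fin.sum_univ_add] at h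
  simp only [par_castAdd, par_natAdd, sg, if_true, one_ne_zero, if_false, one_mul, neg_mul,
    Finset.sum_neg_distrib] at h
  linear_combination h

variable (K) in
/-- The lower left block of a matrix of `sl(3|2)`. -/
def lowerBlock : sl K 3 2 →ₗ[K] Fin 2 → Fin 3 → K where
  toFun A a i := (A : gl K 3 2) (Fin.natAdd 3 a) (Fin.castAdd 2 i)
  map_add' _ _ := rfl
  map_smul' _ _ := rfl

lemma lowerBlock_apply (A : sl K 3 2) (a i) :
    lowerBlock K A a i = (A : gl K 3 2) (Fin.natAdd 3 a) (Fin.castAdd 2 i) := rfl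

variable (K) in
/-- The upper right block of a matrix of `sl(3|2)`, transposed. -/
def upperBlock : sl K 3 2 →ₗ[K] Fin 2 → Fin 3 → K where
  toFun A a i := (A : gl K 3 2) (Fin.castAdd 2 i) (Fin.natAdd 3 a)
  map_add' _ _ := rfl
  map_smul' _ _ := rfl

lemma upperBlock_apply (A : sl K 3 2) (a i) :
    upperBlock K A a i = (A : gl K 3 2) (Fin.castAdd 2 i) (Fin.natAdd 3 a) := rfl

variable (K) in
/-- The action of `sl(3|2)` on its vector module. -/
def vecAction (_ _ : ZMod 2) : sl K 3 2 →ₗ[K] M5 K →ₗ[K] M5 K :=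
  (Matrix.mulVecBilin K K).comp (sl K 3 2).subtype

lemma vecAction_apply (p q : ZMod 2) (A : sl K 3 2) (l : M5 K) :
    vecAction K p q A l = Matrix.mulVec (A : gl K 3 2) l := rfl

variable (K) in
/-- The action of `sl(3|2)` on its covector module. -/
def dualAction (p q : ZMod 2) : sl K 3 2 →ₗ[K] M5 K →ₗ[K] M5 K :=
  -(sg K (p * q) • (Matrix.vecMulBilin K K).flip.comp (sl K 3 2).subtype)

lemma dualAction_apply (p q : ZMod 2) (A : sl K 3 2) (l : M5 K) :
    dualAction K p q A l = dAct K p A q l := rfl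

lemma slBracket_comm_of_isHom_zero {p : ZMod 2} {A X : sl K 3 2} (hA : IsHom K p (A : gl K 3 2))
    (hX : IsHom K 0 (X : gl K 3 2)) : slBracket K A X = -slBracket K X A := by
  ext : 1
  rw [Submodule.coe_neg, coe_slBracket, coe_slBracket, sbr_eq hA hX, sbr_eq hX hA]
  simp [sg]

lemma IsHom.sbr {p q : ZMod 2} {A B : gl K 3 2} (hA : IsHom K p A) (hB : IsHom K q B) :
    IsHom K (p + q) (sbr K A B) := by
  have hmul : ∀ {p q : ZMod 2} {A B : gl K 3 2}, IsHom K p A → IsHom K q B →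
      ∀ i j, par 3 2 i + par 3 2 j ≠ p + q → (A * B) i j = 0 := by
    intro p q A B hA hB i j h
    rw [Matrix.mul_apply]
    refine Finset.sum_eq_zero fun k _ => ?_
    by_contra hk
    have h₁ := hA i k (left_ne_zero_of_mul hk)
    have h₂ := hB k j (right_ne_zero_of_mul hk)
    refine h ?_
    rw [← h₁, ← h₂, add_assoc, CharTwo.add_cancel_left]
  intro i j h
  by_contra hij
  rw [sbr_eq hA hB] at h
  simp [hmul hA hB i j hij, hmul hB hA i j (by rwa [add_comm q p])] at h

lemma isCocycle_crossForm {ρ : ZMod 2 → ZMod 2 → sl K 3 2 →ₗ[K] M5 K →ₗ[K] M5 K}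
    {x : sl K 3 2 →ₗ[K] Fin 2 → Fin 3 → K}
    (hx : ∀ A : sl K 3 2, IsHom K 0 (A : gl K 3 2) → x A = 0)
    (heven : ∀ X A B : sl K 3 2, IsHom K 0 (X : gl K 3 2) → IsHom K 1 (A : gl K 3 2) →
      IsHom K 1 (B : gl K 3 2) → ρ 0 0 X (crossForm K x A B)
        = crossForm K x (slBracket K X A) B + crossForm K x A (slBracket K X B))
    (hodd : ∀ A B C : sl K 3 2, IsHom K 1 (A : gl K 3 2) → IsHom K 1 (B : gl K 3 2) →
      IsHom K 1 (C : gl K 3 2) → ρ 1 0 A (crossForm K x B C) + ρ 1 0 B (crossForm K x A C)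
        + ρ 1 0 C (crossForm K x A B) = 0) :
    IsCocycleFor ρ 0 (crossForm K x) := by
  have hl : ∀ A B : sl K 3 2, IsHom K 0 (A : gl K 3 2) → crossForm K x A B = 0 := by
    intro A B hA
    ext i
    refine Fin.addCases (fun k => ?_) (fun a => ?_) i <;> simp [hx A hA]
  have hr : ∀ A B : sl K 3 2, IsHom K 0 (B : gl K 3 2) → crossForm K x A B = 0 := by
    intro A B hB
    ext i
    refine Fin.addCases (fun k => ?_) (fun a => ?_) i <;> simp [hx B hB]
  have h11 : (1 : ZMod 2) + 1 = 0 := rfl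
  intro pA pB pC A B C AB AC BC hA hB hC hAB hAC hBC
  obtain rfl : AB = slBracket K A B := Subtype.ext hAB
  obtain rfl : AC = slBracket K A C := Subtype.ext hAC
  obtain rfl : BC = slBracket K B C := Subtype.ext hBC
  clear hAB hAC hBC
  have hAB := hA.sbr hB
  have hAC := hA.sbr hC
  have hBC := hB.sbr hC
  rw [← coe_slBracket] at hAB hAC hBC
  obtain rfl | rfl := ZMod.eq_zero_or_eq_one pA <;>
  obtain rfl | rfl := ZMod.eq_zero_or_eq_one pB <;>
  obtain rfl | rfl := ZMod.eq_zero_or_eq_one pC <;>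
  simp only [h11, add_zero, zero_add, mul_zero, mul_one, sg, if_true, one_ne_zero,
    if_false, one_smul, neg_smul] at hAB hAC hBC ⊢
  · simp [hl A _ hA, hl B _ hB, hl _ _ hAB, hl _ _ hAC]
  · simp [hl A _ hA, hl B _ hB, hl _ _ hAB, hr _ _ hB]
  · simp [hl A _ hA, hr _ _ hC, hl _ _ hAC]
  · have h := (isCochain_crossForm hx).2 1 1 B _ hB hAC
    simp only [sg, mul_one, one_ne_zero, if_false, neg_smul, one_smul, neg_neg] at h
    rw [hl A B hA, hl A C hA, hl A _ hA, heven A B C hA hB hC, h]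
    simp
  · simp [hr _ _ hB, hr _ _ hC, hr _ _ hBC]
  · rw [hr A B hB, hl B C hB, hr _ B hB, heven B A C hB hA hC,
      slBracket_comm_of_isHom_zero hA hB]
    simp
  · rw [hr A C hC, hr B C hC, hr _ C hC, heven C A B hC hA hB,
      slBracket_comm_of_isHom_zero hA hC, slBracket_comm_of_isHom_zero hB hC]
    simp
  · have h := hodd A B C hA hB hC
    rw [hl _ _ hAB, hl _ _ hAC, hr _ _ hBC]
    simp only [sub_neg_eq_add, neg_zero, sub_zero, add_zero]
    exact h

lemma cross_invariant {M : Fin 3 → Fin 3 → K} {D : Fin 2 → Fin 2 → K}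
    (h : ∑ i, M i i = ∑ a, D a a) {x y x' y' : Fin 2 → Fin 3 → K}
    (hx : ∀ a i, x' a i = ∑ b, D a b * x b i - ∑ j, M j i * x a j)
    (hy : ∀ a i, y' a i = ∑ b, D a b * y b i - ∑ j, M j i * y a j) (k : Fin 3) :
    ∑ j, M k j * (x 0 ⨯₃ y 1 - x 1 ⨯₃ y 0) j
      = (x' 0 ⨯₃ y 1 - x' 1 ⨯₃ y 0) k + (x 0 ⨯₃ y' 1 - x 1 ⨯₃ y' 0) k := by
  simp only [Fin.sum_univ_three, Fin.sum_univ_two] at h hx hy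
  fin_cases k <;> simp [Fin.sum_univ_three, cross_apply, hx, hy]
  · linear_combination (x 0 1 * y 1 2 - x 0 2 * y 1 1 - x 1 1 * y 0 2 + x 1 2 * y 0 1) * h
  · linear_combination (x 0 2 * y 1 0 - x 0 0 * y 1 2 - x 1 2 * y 0 0 + x 1 0 * y 0 2) * h
  · linear_combination (x 0 0 * y 1 1 - x 0 1 * y 1 0 - x 1 0 * y 0 1 + x 1 1 * y 0 0) * h

lemma sum_cross_cyclic (x y z : Fin 2 → Fin 3 → K) (a : Fin 2) :
    ∑ j, x a j * (y 0 ⨯₃ z 1 - y 1 ⨯₃ z 0) j + ∑ j, y a j * (x 0 ⨯₃ z 1 - x 1 ⨯₃ z 0) j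
      + ∑ j, z a j * (x 0 ⨯₃ y 1 - x 1 ⨯₃ y 0) j = 0 := by
  fin_cases a <;> simp [Fin.sum_univ_three, cross_apply] <;> ring

lemma isHom_zero_lowerBlock {A : sl K 3 2} (hA : IsHom K 0 (A : gl K 3 2)) :
    lowerBlock K A = 0 := by
  ext a i
  exact hA.apply_natAdd_castAdd i a

lemma isHom_zero_upperBlock {A : sl K 3 2} (hA : IsHom K 0 (A : gl K 3 2)) :
    upperBlock K A = 0 := by
  ext a i
  exact hA.apply_castAdd_natAdd i a

lemma isCocycle_lowerBlock : IsCocycleFor (vecAction K) 0 (crossForm K (lowerBlock K)) := by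
  refine isCocycle_crossForm (fun A hA => isHom_zero_lowerBlock hA) ?_ ?_
  · intro X A B hX hA hB
    have hbr : ∀ A : sl K 3 2, IsHom K 1 (A : gl K 3 2) → ∀ a i,
        lowerBlock K (slBracket K X A) a i
          = ∑ b, (X : gl K 3 2) (Fin.natAdd 3 a) (Fin.natAdd 3 b) * lowerBlock K A b i
            - ∑ j, (X : gl K 3 2) (Fin.castAdd 2 j) (Fin.castAdd 2 i) * lowerBlock K A a j := by
      intro A hA a i
      rw [lowerBlock_apply, coe_slBracket, sbr_eq hX hA]
      rw [Matrix.sub_apply, Matrix.smul_apply, Matrix.mul_apply, Matrix.mul_apply, Fin.sum_univ_add,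
        Fin.sum_univ_add]
      simp only [lowerBlock_apply, hX.apply_natAdd_castAdd, sg, zero_mul,
        if_true, one_smul, Finset.sum_const_zero, zero_add, add_zero, mul_comm]
    ext i
    rw [vecAction_apply, Matrix.mulVec, dotProduct, Fin.sum_univ_add]
    refine Fin.addCases (fun k => ?_) (fun a => ?_) i
    · simp only [crossForm_castAdd, crossForm_natAdd, mul_zero, Finset.sum_const_zero, add_zero,
        Pi.add_apply]
      exact cross_invariant (str_eq_zero X) (hbr A hA) (hbr B hB) k
    · simp [hX.apply_natAdd_castAdd]
  · intro A B C hA hB hC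
    ext i
    simp only [vecAction_apply, Matrix.mulVec, dotProduct, Pi.add_apply]
    rw [Fin.sum_univ_add, Fin.sum_univ_add, Fin.sum_univ_add]
    refine Fin.addCases (fun k => ?_) (fun a => ?_) i
    · simp [hA.apply_castAdd_castAdd, hB.apply_castAdd_castAdd, hC.apply_castAdd_castAdd]
    · simp only [crossForm_castAdd, crossForm_natAdd, mul_zero, Finset.sum_const_zero, add_zero]
      exact sum_cross_cyclic (lowerBlock K A) (lowerBlock K B) (lowerBlock K C) a

lemma isCocycle_upperBlock : IsCocycleFor (dualAction K) 0 (crossForm K (upperBlock K)) := by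
  refine isCocycle_crossForm (fun A hA => isHom_zero_upperBlock hA) ?_ ?_
  · intro X A B hX hA hB
    have hbr : ∀ A : sl K 3 2, IsHom K 1 (A : gl K 3 2) → ∀ a i,
        upperBlock K (slBracket K X A) a i
          = ∑ b, -(X : gl K 3 2) (Fin.natAdd 3 b) (Fin.natAdd 3 a) * upperBlock K A b i
            - ∑ j, -(X : gl K 3 2) (Fin.castAdd 2 i) (Fin.castAdd 2 j) * upperBlock K A a j := by
      intro A hA a i
      rw [upperBlock_apply, coe_slBracket, sbr_eq hX hA]
      rw [Matrix.sub_apply, Matrix.smul_apply, Matrix.mul_apply, Matrix.mul_apply, Fin.sum_univ_add,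
        Fin.sum_univ_add]
      simp only [upperBlock_apply, hX.apply_castAdd_natAdd, sg, zero_mul,
        if_true, one_smul, Finset.sum_const_zero, zero_add, add_zero, mul_comm, neg_mul,
        Finset.sum_neg_distrib]
      ring
    ext i
    simp only [dualAction_apply, dAct, Matrix.vecMul, dotProduct, Pi.neg_apply, Pi.smul_apply]
    rw [Fin.sum_univ_add]
    refine Fin.addCases (fun k => ?_) (fun a => ?_) i
    · have h := cross_invariant (M := fun k j => -(X : gl K 3 2) (Fin.castAdd 2 j) (Fin.castAdd 2 k))
        (D := fun a b => -(X : gl K 3 2) (Fin.natAdd 3 b) (Fin.natAdd 3 a))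
        (by simpa only [Finset.sum_neg_distrib, neg_inj] using str_eq_zero X)
        (hbr A hA) (hbr B hB) k
      simp only [crossForm_castAdd, crossForm_natAdd, zero_mul, Finset.sum_const_zero, add_zero,
        Pi.add_apply, sg, if_true, one_smul, ← h, neg_mul, Finset.sum_neg_distrib, mul_comm]
    · simp [hX.apply_castAdd_natAdd]
  · intro A B C hA hB hC
    ext i
    simp only [dualAction_apply, dAct, Matrix.vecMul, dotProduct, Pi.add_apply, Pi.neg_apply,
      Pi.smul_apply]
    rw [Fin.sum_univ_add, Fin.sum_univ_add, Fin.sum_univ_add]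
    refine Fin.addCases (fun k => ?_) (fun a => ?_) i
    · simp [hA.apply_castAdd_castAdd, hB.apply_castAdd_castAdd, hC.apply_castAdd_castAdd]
    · have h := sum_cross_cyclic (upperBlock K A) (upperBlock K B) (upperBlock K C) a
      simp only [upperBlock_apply] at h
      simp only [crossForm_castAdd, crossForm_natAdd, Finset.sum_const_zero, add_zero,
        sg, mul_zero, if_true, one_smul, mul_comm _ ((_ : gl K 3 2) _ _), Pi.zero_apply]
      linear_combination -h

/-- The matrix unit `E i j` with `i ≠ j` as an element of `sl(3|2)`. -/
def offDiag (i j : Fin (3 + 2)) (h : i ≠ j) : sl K 3 2 :=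
  ⟨Matrix.single i j 1, (mem_sl K).mpr <| Finset.sum_eq_zero fun k _ => by
    rw [Matrix.single_apply, if_neg (by rintro ⟨rfl, rfl⟩; exact h rfl), mul_zero]⟩

@[simp] lemma coe_offDiag (i j : Fin (3 + 2)) (h : i ≠ j) :
    ((offDiag i j h : sl K 3 2) : gl K 3 2) = Matrix.single i j 1 := rfl

lemma castAdd_ne_natAdd (i : Fin 3) (a : Fin 2) : Fin.castAdd 2 i ≠ Fin.natAdd 3 a := by
  intro h
  have := congrArg wt h
  simp at this

lemma isHom_single {p : ZMod 2} {i j : Fin (3 + 2)} (h : par 3 2 i + par 3 2 j = p) (c : K) :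
    IsHom K p (Matrix.single i j c : gl K 3 2) := by
  intro k l hkl
  rw [Matrix.single_apply] at hkl
  obtain ⟨rfl, rfl⟩ := (ite_ne_right_iff.mp hkl).1
  exact h

lemma hasWt_single {s : ℤ} {i j : Fin (3 + 2)} (h : wt i - wt j = s) (c : K) :
    HasWt K s (Matrix.single i j c : gl K 3 2) := by
  intro k l hkl
  rw [Matrix.single_apply] at hkl
  obtain ⟨rfl, rfl⟩ := (ite_ne_right_iff.mp hkl).1
  exact h

lemma IsHom.neg {p : ZMod 2} {A : gl K 3 2} (hA : IsHom K p A) : IsHom K p (-A) :=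
  fun i j h => hA i j (by simpa using h)

lemma slCenter_apply (i j) : (slCenter K : gl K 3 2) i j = if i = j then (wt i : K) else 0 :=
  rfl

lemma vecAction_slCenter (p q : ZMod 2) (l : M5 K) (i) :
    vecAction K p q (slCenter K) l i = ((1 * wt i : ℤ) : K) * l i := by
  simp [vecAction_apply, Matrix.mulVec, dotProduct, slCenter_apply]

lemma dualAction_slCenter (q : ZMod 2) (l : M5 K) (i) :
    dualAction K 0 q (slCenter K) l i = ((-1 * wt i : ℤ) : K) * l i := by
  simp [dualAction_apply, dAct, Matrix.vecMul, dotProduct, slCenter_apply, sg, mul_comm]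

lemma vecAction_weight (p q : ZMod 2) (A : sl K 3 2) (s t : ℤ) (l l' : M5 K)
    (hA : HasWt K s (A : gl K 3 2)) (hl : ∀ i, l i = ((1 * wt i - t : ℤ) : K) * l' i) (i) :
    vecAction K p q A l i = ((1 * wt i - (s + t) : ℤ) : K) * vecAction K p q A l' i := by
  simp only [vecAction_apply, Matrix.mulVec, dotProduct, Finset.mul_sum]
  refine Finset.sum_congr rfl fun j _ => ?_
  by_cases h : (A : gl K 3 2) i j = 0
  · simp [h]
  · rw [hl, ← hA i j h]
    push_cast
    ring

lemma dualAction_weight (p q : ZMod 2) (A : sl K 3 2) (s t : ℤ) (l l' : M5 K)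
    (hA : HasWt K s (A : gl K 3 2)) (hl : ∀ i, l i = ((-1 * wt i - t : ℤ) : K) * l' i) (i) :
    dualAction K p q A l i = ((-1 * wt i - (s + t) : ℤ) : K) * dualAction K p q A l' i := by
  simp only [dualAction_apply, dAct, Matrix.vecMul, dotProduct, Pi.neg_apply, Pi.smul_apply,
    smul_eq_mul, mul_neg, Finset.mul_sum]
  rw [← Finset.sum_neg_distrib, ← Finset.sum_neg_distrib]
  refine Finset.sum_congr rfl fun j _ => ?_
  by_cases h : (A : gl K 3 2) j i = 0
  · simp [h]
  · rw [hl, ← hA j i h]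
    push_cast
    ring

lemma HasWt.apply_eq_zero {s : ℤ} {A : gl K 3 2} (hA : HasWt K s A) {i j} (h : wt i - wt j ≠ s) :
    A i j = 0 := by
  by_contra h'
  exact h (hA i j h')

lemma vecAction_top (p q : ZMod 2) (A : sl K 3 2) (l : M5 K) (hA : HasWt K 1 (A : gl K 3 2)) (i)
    (hi : wt i = 2) : vecAction K p q A l i = 0 := by
  rw [vecAction_apply, Matrix.mulVec, dotProduct]
  refine Finset.sum_eq_zero fun j _ => ?_
  have hj : 2 ≤ wt j := by
    unfold wt
    split_ifs <;> norm_num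
  rw [hA.apply_eq_zero (by omega), zero_mul]

lemma dualAction_top (p q : ZMod 2) (A : sl K 3 2) (l : M5 K) (hA : HasWt K (-1) (A : gl K 3 2)) (i)
    (hi : wt i = 2) : dualAction K p q A l i = 0 := by
  rw [dualAction_apply, dAct, Pi.neg_apply, Pi.smul_apply, Matrix.vecMul, dotProduct,
    Finset.sum_eq_zero, smul_zero, neg_zero]
  intro j _
  have hj : 2 ≤ wt j := by
    unfold wt
    split_ifs <;> norm_num
  rw [hA.apply_eq_zero (by omega), mul_zero]

lemma eq_sum_lowerBlock (A : sl K 3 2) (hA : HasWt K 1 (A : gl K 3 2)) :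
    A = ∑ a, ∑ i, lowerBlock K A a i •
      offDiag (Fin.natAdd 3 a) (Fin.castAdd 2 i) (castAdd_ne_natAdd i a).symm := by
  ext i j
  simp only [Submodule.coe_sum, Submodule.coe_smul, coe_offDiag, Matrix.sum_apply,
    Matrix.smul_apply, Matrix.single_apply, lowerBlock_apply]
  refine Fin.addCases (fun k => ?_) (fun a => ?_) i
  · rw [hA.apply_eq_zero]
    · simp [(castAdd_ne_natAdd _ _).symm]
    · have := wt_castAdd k
      have : 2 ≤ wt j := by
        unfold wt
        split_ifs <;> norm_num
      omega
  · refine Fin.addCases (fun k => ?_) (fun b => ?_) j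
    · simp [ite_and, (Fin.castAdd_injective 3 2).eq_iff,
        (Fin.natAdd_injective 2 3).eq_iff, -Fin.sum_univ_two]
    · rw [hA.apply_eq_zero (by simp)]
      simp [castAdd_ne_natAdd]

lemma eq_sum_upperBlock (A : sl K 3 2) (hA : HasWt K (-1) (A : gl K 3 2)) :
    A = ∑ a, ∑ i, upperBlock K A a i •
      offDiag (Fin.castAdd 2 i) (Fin.natAdd 3 a) (castAdd_ne_natAdd i a) := by
  ext i j
  simp only [Submodule.coe_sum, Submodule.coe_smul, coe_offDiag, Matrix.sum_apply,
    Matrix.smul_apply, Matrix.single_apply, upperBlock_apply]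
  refine Fin.addCases (fun k => ?_) (fun b => ?_) j
  · rw [hA.apply_eq_zero]
    · simp [(castAdd_ne_natAdd _ _).symm]
    · have := wt_castAdd k
      have : 2 ≤ wt i := by
        unfold wt
        split_ifs <;> norm_num
      omega
  · refine Fin.addCases (fun k => ?_) (fun b => ?_) i
    · simp [ite_and, (Fin.castAdd_injective 3 2).eq_iff,
        (Fin.natAdd_injective 2 3).eq_iff, -Fin.sum_univ_two]
    · rw [hA.apply_eq_zero (by simp)]
      simp [castAdd_ne_natAdd]

lemma sbr_of_isHom_zero {p : ZMod 2} {A B : gl K 3 2} (hA : IsHom K 0 A) (hB : IsHom K p B) :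
    sbr K A B = A * B - B * A := by
  simp [sbr_eq hA hB, sg]

theorem exists_generator_vec [CharZero K] :
    ∃ (p₀ : ZMod 2) (g : sl K 3 2 →ₗ[K] sl K 3 2 →ₗ[K] M5 K),
      IsCochain32 K p₀ g ∧ IsCocycleVec K p₀ g ∧ ¬ IsCoboundaryVec K p₀ g ∧
      ∀ (p : ZMod 2) (f : sl K 3 2 →ₗ[K] sl K 3 2 →ₗ[K] M5 K),
        IsCochain32 K p f → IsCocycleVec K p f →
        ∃ c : K, IsCoboundaryVec K p (f - c • g) := by
  have he : ∀ a i, HasWt K 1 (offDiag (Fin.natAdd 3 a) (Fin.castAdd 2 i)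
      (castAdd_ne_natAdd i a).symm : sl K 3 2).1 := fun a i => hasWt_single (by simp) 1
  refine existsUnique_cocycle (ρ := vecAction K) (x := lowerBlock K) (Or.inl rfl)
    (vecAction_slCenter 0) vecAction_weight vecAction_top ?_ (fun A hA => isHom_zero_lowerBlock hA)
    he ?_ eq_sum_lowerBlock ?_ ?_ isCocycle_lowerBlock
  · intro s A hA hs
    ext a i
    exact hA.apply_eq_zero (by simpa using hs.symm)
  · intro a i b j
    simp [lowerBlock_apply, Matrix.single_apply, (Fin.castAdd_injective 3 2).eq_iff,
      (Fin.natAdd_injective 2 3).eq_iff]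
  · intro l m hlm
    have hX : IsHom K 0 (Matrix.single (Fin.castAdd 2 l) (Fin.castAdd 2 m) 1 : gl K 3 2) :=
      isHom_single (by simp) 1
    refine ⟨offDiag (Fin.castAdd 2 l) (Fin.castAdd 2 m) ((Fin.castAdd_injective 3 2).ne hlm),
      hX, ?_, ?_⟩
    · intro a i
      ext : 1
      refine (sbr_of_isHom_zero hX ((he a i).isHom_one (Or.inl rfl))).trans ?_
      split_ifs with h
      · simp [h, castAdd_ne_natAdd]
      · simp [Matrix.single_mul_single_of_ne _ _ _ _ ((Fin.castAdd_injective 3 2).ne h),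
          castAdd_ne_natAdd]
    · intro q v k
      simp [vecAction_apply, Matrix.mulVec, dotProduct, Matrix.single_apply, ite_and,
        (Fin.castAdd_injective 3 2).eq_iff, eq_comm]
  · intro c d hcd
    have hX : IsHom K 0 (Matrix.single (Fin.natAdd 3 c) (Fin.natAdd 3 d) 1 : gl K 3 2) :=
      isHom_single (by simp [CharTwo.add_self_eq_zero]) 1
    refine ⟨offDiag (Fin.natAdd 3 c) (Fin.natAdd 3 d) ((Fin.natAdd_injective 2 3).ne hcd),
      hX, ?_, ?_⟩
    · intro a i
      ext : 1
      refine (sbr_of_isHom_zero hX ((he a i).isHom_one (Or.inl rfl))).trans ?_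
      split_ifs with h
      · simp [h, castAdd_ne_natAdd]
      · simp [Matrix.single_mul_single_of_ne _ _ _ _ ((Fin.natAdd_injective 2 3).ne (Ne.symm h)),
          castAdd_ne_natAdd]
    · intro q v k
      simp [vecAction_apply, Matrix.mulVec, dotProduct, (castAdd_ne_natAdd _ _).symm]

theorem exists_generator_dual [CharZero K] :
    ∃ (p₀ : ZMod 2) (g : sl K 3 2 →ₗ[K] sl K 3 2 →ₗ[K] M5 K),
      IsCochain32 K p₀ g ∧ IsCocycleDual K p₀ g ∧ ¬ IsCoboundaryDual K p₀ g ∧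
      ∀ (p : ZMod 2) (f : sl K 3 2 →ₗ[K] sl K 3 2 →ₗ[K] M5 K),
        IsCochain32 K p f → IsCocycleDual K p f →
        ∃ c : K, IsCoboundaryDual K p (f - c • g) := by
  have he : ∀ a i, HasWt K (-1) (offDiag (Fin.castAdd 2 i) (Fin.natAdd 3 a)
      (castAdd_ne_natAdd i a) : sl K 3 2).1 := fun a i => hasWt_single (by simp) 1
  refine existsUnique_cocycle (ρ := dualAction K) (x := upperBlock K) (Or.inr rfl)
    dualAction_slCenter dualAction_weight dualAction_top ?_
    (fun A hA => isHom_zero_upperBlock hA) he ?_ eq_sum_upperBlock ?_ ?_ isCocycle_upperBlock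
  · intro s A hA hs
    ext a i
    exact hA.apply_eq_zero (by simpa using hs.symm)
  · intro a i b j
    simp [upperBlock_apply, Matrix.single_apply, (Fin.castAdd_injective 3 2).eq_iff,
      (Fin.natAdd_injective 2 3).eq_iff, and_comm]
  · intro l m hlm
    have hX : IsHom K 0 (-Matrix.single (Fin.castAdd 2 m) (Fin.castAdd 2 l) 1 : gl K 3 2) :=
      (isHom_single (by simp) 1).neg
    refine ⟨-offDiag (Fin.castAdd 2 m) (Fin.castAdd 2 l) ((Fin.castAdd_injective 3 2).ne hlm.symm),
      hX, ?_, ?_⟩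
    · intro a i
      ext : 1
      refine (sbr_of_isHom_zero hX ((he a i).isHom_one (Or.inr rfl))).trans ?_
      split_ifs with h
      · simp [h, (castAdd_ne_natAdd _ _).symm]
      · simp [Matrix.single_mul_single_of_ne _ _ _ _ ((Fin.castAdd_injective 3 2).ne (Ne.symm h)),
          (castAdd_ne_natAdd _ _).symm]
    · intro q v k
      simp [dualAction_apply, dAct, Matrix.vecMul, dotProduct, Matrix.single_apply, ite_and,
        (Fin.castAdd_injective 3 2).eq_iff, eq_comm, sg]
  · intro c d hcd
    have hX : IsHom K 0 (-Matrix.single (Fin.natAdd 3 d) (Fin.natAdd 3 c) 1 : gl K 3 2) :=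
      (isHom_single (by simp [CharTwo.add_self_eq_zero]) 1).neg
    refine ⟨-offDiag (Fin.natAdd 3 d) (Fin.natAdd 3 c) ((Fin.natAdd_injective 2 3).ne hcd.symm),
      hX, ?_, ?_⟩
    · intro a i
      ext : 1
      refine (sbr_of_isHom_zero hX ((he a i).isHom_one (Or.inr rfl))).trans ?_
      split_ifs with h
      · simp [h, (castAdd_ne_natAdd _ _).symm]
      · simp [Matrix.single_mul_single_of_ne _ _ _ _ ((Fin.natAdd_injective 2 3).ne h),
          (castAdd_ne_natAdd _ _).symm]
    · intro q v k
      simp [dualAction_apply, dAct, Matrix.vecMul, dotProduct, (castAdd_ne_natAdd _ _).symm]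

/-- Let `L = sl(3|2)` and `M = 𝕂⁵` its natural (vector) module.  Then
`dim H²(L,M) = 1`, and the same holds for the graded dual (covector) module `M*`. -/
theorem second_cohomology_sl_3_2_vector_module_one_dimensional
    (K : Type) [Field K] [IsAlgClosed K] [CharZero K] :
    -- `dim H²(L, M) = 1` for the vector module:
    (∃ (p₀ : ZMod 2) (g : ↥(sl K 3 2) →ₗ[K] ↥(sl K 3 2) →ₗ[K] M5 K),
      IsCochain32 K p₀ g ∧ IsCocycleVec K p₀ g ∧ ¬ IsCoboundaryVec K p₀ g ∧
      ∀ (p : ZMod 2) (f : ↥(sl K 3 2) →ₗ[K] ↥(sl K 3 2) →ₗ[K] M5 K),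
        IsCochain32 K p f → IsCocycleVec K p f →
        ∃ c : K, IsCoboundaryVec K p (f - c • g)) ∧
    -- `dim H²(L, M*) = 1` for the covector module:
    (∃ (p₀ : ZMod 2) (g : ↥(sl K 3 2) →ₗ[K] ↥(sl K 3 2) →ₗ[K] M5 K),
      IsCochain32 K p₀ g ∧ IsCocycleDual K p₀ g ∧ ¬ IsCoboundaryDual K p₀ g ∧
      ∀ (p : ZMod 2) (f : ↥(sl K 3 2) →ₗ[K] ↥(sl K 3 2) →ₗ[K] M5 K),
        IsCochain32 K p f → IsCocycleDual K p f →
        ∃ c : K, IsCoboundaryDual K p (f - c • g)) := by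
  exact ⟨exists_generator_vec, exists_generator_dual⟩
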